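/- arXiv:2409.16286 — 2 statements merged into one kernel-verified Lean document; each statement's English description precedes it below -/
import Mathlib

section
/- Let Z be a Banach space whose norm is strongly subdifferentiable (SSD) at every point of its unit sphere. Let z_1, …, z_n ∈ S_Z be such that there exists f ∈ S_{Z*} with f(z_i) = 1 for every 1 ≤ i ≤ n. Then for every ε > 0 there exists η > 0 with the following property: if g ∈ B_{Z*} satisfies g(z_i) > 1 − η for every 1 ≤ i ≤ n, then there exists h ∈ S_{Z*} such that h(z_i) = 1 for every 1 ≤ i ≤ n and ‖g − h‖ < ε. -/
/-- `z` is an SSD point of the unit sphere of `Z`: `‖z‖ = 1` and the one-sided limit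
`lim_{t → 0⁺} (‖z + t • h‖ - 1) / t` exists uniformly in `h` on the unit sphere of `Z`. -/
def IsSSDPoint {Z : Type*} [NormedAddCommGroup Z] [NormedSpace ℝ Z] (z : Z) : Prop :=
  ‖z‖ = 1 ∧ ∃ G : Z → ℝ, ∀ ε > (0 : ℝ), ∃ δ > (0 : ℝ), ∀ t : ℝ, 0 < t → t < δ →
    ∀ h : Z, ‖h‖ = 1 → |(‖z + t • h‖ - 1) / t - G h| < ε

open Filter Topology in
lemma tendsto_const_mul_nhdsGT_zero {c : ℝ} (hc : 0 < c) :
    Tendsto (fun t : ℝ => c * t) (𝓝[>] 0) (𝓝[>] 0) := by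
  refine tendsto_nhdsWithin_iff.mpr ⟨?_, ?_⟩
  · have : Tendsto (fun t : ℝ => c * t) (𝓝 0) (𝓝 (c * 0)) :=
      (continuous_const.mul continuous_id).tendsto 0
    rw [mul_zero] at this
    exact this.mono_left nhdsWithin_le_nhds
  · filter_upwards [self_mem_nhdsWithin] with t ht
    exact mul_pos hc ht

open Filter Topology in
/-- At an SSD point the norm has a directional derivative in every direction, and the difference
quotients converge to it uniformly on the unit sphere. -/
lemma IsSSDPoint.exists_directional_derivative {Z : Type*} [NormedAddCommGroup Z] [NormedSpace ℝ Z]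
    {z : Z} (hz : IsSSDPoint z) :
    ∃ τ : Z → ℝ, (∀ x, Tendsto (fun t : ℝ => (‖z + t • x‖ - 1) / t) (𝓝[>] 0) (𝓝 (τ x))) ∧
      ∀ ε > (0 : ℝ), ∃ δ > (0 : ℝ), ∀ t : ℝ, 0 < t → t < δ →
        ∀ x : Z, ‖x‖ = 1 → |(‖z + t • x‖ - 1) / t - τ x| < ε := by
  obtain ⟨hz1, G, hG⟩ := hz
  have hlim : ∀ x : Z, ‖x‖ = 1 →
      Tendsto (fun t : ℝ => (‖z + t • x‖ - 1) / t) (𝓝[>] 0) (𝓝 (G x)) := by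
    intro x hx
    rw [Metric.tendsto_nhds]
    intro ε hε
    obtain ⟨δ, hδ, h⟩ := hG ε hε
    filter_upwards [Ioo_mem_nhdsGT hδ] with t ht
    exact h t ht.1 ht.2 x hx
  refine ⟨fun x => ‖x‖ * G (‖x‖⁻¹ • x), fun x => ?_, fun ε hε => ?_⟩
  · rcases eq_or_ne x 0 with rfl | hx
    · simp [hz1]
    have hx0 : 0 < ‖x‖ := norm_pos_iff.mpr hx
    have hunit : ‖‖x‖⁻¹ • x‖ = 1 := by simp [norm_smul, hx0.ne']
    refine (((hlim _ hunit).comp (tendsto_const_mul_nhdsGT_zero hx0)).const_mul ‖x‖).congr' ?_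
    filter_upwards [self_mem_nhdsWithin] with t ht
    have ht' : t ≠ 0 := ne_of_gt ht
    have : (‖x‖ * t) • ‖x‖⁻¹ • x = t • x := by
      rw [smul_smul]; congr 1; field_simp
    simp only [Function.comp, this]
    field_simp
  · obtain ⟨δ, hδ, h⟩ := hG ε hε
    refine ⟨δ, hδ, fun t ht ht' x hx => ?_⟩
    simpa [hx] using h t ht ht' x hx

/-- Hahn–Banach decomposition: a linear functional dominated by the sum of two sublinear functions
is the sum of linear functionals dominated by each of them. -/
lemma LinearMap.exists_add_eq_of_le_add_sublinear {E : Type*} [AddCommGroup E] [Module ℝ E]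
    (g : E →ₗ[ℝ] ℝ) {p q : E → ℝ}
    (hp : ∀ c : ℝ, 0 < c → ∀ x, p (c • x) = c * p x) (hp' : ∀ x y, p (x + y) ≤ p x + p y)
    (hq : ∀ c : ℝ, 0 < c → ∀ x, q (c • x) = c * q x) (hq' : ∀ x y, q (x + y) ≤ q x + q y)
    (hg : ∀ x, g x ≤ p x + q x) :
    ∃ φ ψ : E →ₗ[ℝ] ℝ, φ + ψ = g ∧ (∀ x, φ x ≤ p x) ∧ ∀ x, ψ x ≤ q x := by
  have hzero : ∀ r : E → ℝ, (∀ c : ℝ, 0 < c → ∀ x, r (c • x) = c * r x) → r 0 = 0 := by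
    intro r hr
    have := hr 2 two_pos 0
    rw [smul_zero] at this
    linarith
  let D : (E × E) →ₗ.[ℝ] ℝ :=
    { domain := LinearMap.range (LinearMap.id.prod LinearMap.id : E →ₗ[ℝ] E × E)
      toFun := (g ∘ₗ LinearMap.fst ℝ E E) ∘ₗ Submodule.subtype _ }
  obtain ⟨G, hG, hGN⟩ := exists_extension_of_le_sublinear D (fun w => p w.1 + q w.2)
    (fun c hc w => by simp only [Prod.smul_fst, Prod.smul_snd, hp c hc, hq c hc]; ring)
    (fun v w => by
      have := hp' v.1 w.1
      have := hq' v.2 w.2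
      simp only [Prod.fst_add, Prod.snd_add]; linarith)
    (by
      rintro ⟨_, x, rfl⟩
      exact hg x)
  refine ⟨G ∘ₗ LinearMap.inl ℝ E E, G ∘ₗ LinearMap.inr ℝ E E, ?_, fun x => ?_, fun x => ?_⟩
  · ext x
    have h : G (x, x) = g x := hG ⟨(x, x), x, rfl⟩
    simp [← h, ← map_add]
  · simpa [hzero q hq] using hGN (x, 0)
  · simpa [hzero p hp] using hGN (0, x)

open Filter Topology in
/-- At an SSD point `z`, every functional in the dual unit ball which almost attains its norm at `z`
is close to a functional supporting the unit ball at `z`. -/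
lemma IsSSDPoint.exists_support_functional_near {Z : Type*} [NormedAddCommGroup Z]
    [NormedSpace ℝ Z] {z : Z} (hz : IsSSDPoint z) {ε : ℝ} (hε : 0 < ε) :
    ∃ η > (0 : ℝ), ∀ g : Z →L[ℝ] ℝ, ‖g‖ ≤ 1 → 1 - η < g z →
      ∃ h : Z →L[ℝ] ℝ, ‖h‖ = 1 ∧ h z = 1 ∧ ‖g - h‖ < ε := by
  have hz1 := hz.1
  obtain ⟨τ, hlim, hunif⟩ := hz.exists_directional_derivative
  have hhom : ∀ c : ℝ, 0 < c → ∀ x, τ (c • x) = c * τ x := by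
    intro c hc x
    refine tendsto_nhds_unique (hlim (c • x))
      ((((hlim x).comp (tendsto_const_mul_nhdsGT_zero hc)).const_mul c).congr' ?_)
    filter_upwards [self_mem_nhdsWithin] with t ht
    have ht' : t ≠ 0 := ne_of_gt ht
    simp only [Function.comp, smul_smul, mul_comm c t]
    field_simp
  have hadd : ∀ x y, τ (x + y) ≤ τ x + τ y := by
    intro x y
    refine le_of_tendsto_of_tendsto (hlim (x + y))
      (((hlim x).comp (tendsto_const_mul_nhdsGT_zero two_pos)).add
        ((hlim y).comp (tendsto_const_mul_nhdsGT_zero two_pos))) ?_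
    filter_upwards [self_mem_nhdsWithin] with t ht
    have ht' : 0 < t := ht
    simp only [Function.comp]
    have h : 2 * ‖z + t • (x + y)‖ ≤ ‖z + (2 * t) • x‖ + ‖z + (2 * t) • y‖ := by
      have e : (2 : ℝ) • (z + t • (x + y)) = (z + (2 * t) • x) + (z + (2 * t) • y) := by module
      have hnorm := norm_smul (2 : ℝ) (z + t • (x + y))
      rw [Real.norm_two] at hnorm
      exact (hnorm.symm.trans (congrArg norm e)).trans_le (norm_add_le _ _)
    rw [← add_div, div_le_div_iff₀ ht' (by positivity)]
    nlinarith
  have hle : ∀ x, τ x ≤ ‖x‖ := by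
    intro x
    refine le_of_tendsto (hlim x) ?_
    filter_upwards [self_mem_nhdsWithin] with t ht
    have ht' : 0 < t := ht
    rw [div_le_iff₀ ht']
    have := norm_add_le z (t • x)
    rw [norm_smul, Real.norm_of_nonneg ht'.le, hz1] at this
    linarith
  have hneg : τ (-z) ≤ -1 := by
    refine le_of_tendsto (hlim (-z)) ?_
    filter_upwards [Ioo_mem_nhdsGT (zero_lt_one' ℝ)] with t ht
    have e : z + t • (-z) = (1 - t) • z := by module
    rw [div_le_iff₀ ht.1, e, norm_smul, hz1, Real.norm_of_nonneg (by linarith [ht.2])]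
    linarith
  obtain ⟨δ, hδ, hδ'⟩ := hunif (ε / 4) (by positivity)
  refine ⟨δ / 2 * (ε / 4), by positivity, fun g hg hgz => ?_⟩
  have hunit : ∀ x, ‖x‖ = 1 → g x ≤ τ x + ε / 2 := by
    intro x hx
    have ht : 0 < δ / 2 := by positivity
    have h1 := (abs_lt.mp (hδ' (δ / 2) ht (by linarith) x hx)).2
    have h2 : g (z + (δ / 2) • x) ≤ ‖z + (δ / 2) • x‖ :=
      (le_abs_self _).trans ((g.le_of_opNorm_le hg _).trans_eq (one_mul _))
    rw [map_add, map_smul, smul_eq_mul] at h2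
    rw [sub_lt_iff_lt_add, div_lt_iff₀ ht] at h1
    by_contra! h3
    nlinarith [mul_lt_mul_of_pos_left h3 ht]
  have hdom : ∀ x, g x ≤ τ x + ε / 2 * ‖x‖ := by
    intro x
    rcases eq_or_ne x 0 with rfl | hx
    · have := hhom 2 two_pos 0
      rw [smul_zero] at this
      simp only [map_zero, norm_zero]
      linarith
    have hx0 : 0 < ‖x‖ := norm_pos_iff.mpr hx
    have h := hunit (‖x‖⁻¹ • x) (by simp [norm_smul, hx0.ne'])
    rw [hhom _ (inv_pos.mpr hx0), map_smul, smul_eq_mul] at h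
    have h' := mul_le_mul_of_nonneg_left h hx0.le
    rw [mul_add, mul_inv_cancel_left₀ hx0.ne', mul_inv_cancel_left₀ hx0.ne'] at h'
    linarith
  obtain ⟨φ, ψ, hsum, hφ, hψ⟩ :=
    (g : Z →ₗ[ℝ] ℝ).exists_add_eq_of_le_add_sublinear (p := τ) (q := fun x => ε / 2 * ‖x‖) hhom hadd
      (fun c hc x => by rw [norm_smul, Real.norm_of_nonneg hc.le]; ring)
      (fun x y => by rw [← mul_add]; gcongr; exact norm_add_le x y) hdom
  have hφb : ∀ x, ‖φ x‖ ≤ 1 * ‖x‖ := by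
    intro x
    rw [Real.norm_eq_abs, abs_le, one_mul]
    have := (hφ (-x)).trans (hle (-x))
    rw [map_neg, norm_neg] at this
    exact ⟨by linarith, (hφ x).trans (hle x)⟩
  have hφz : φ z = 1 := by
    have h1 := (hφ (-z)).trans hneg
    have h2 := (hφ z).trans (hle z)
    rw [map_neg] at h1
    linarith
  refine ⟨φ.mkContinuous 1 hφb, le_antisymm (φ.mkContinuous_norm_le zero_le_one hφb) ?_, hφz, ?_⟩
  · simpa [hφz, hz1] using (φ.mkContinuous 1 hφb).le_opNorm z
  · refine (ContinuousLinearMap.opNorm_le_bound _ (by positivity) fun x => ?_).trans_lt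
      (half_lt_self hε)
    have e : (g - φ.mkContinuous 1 hφb) x = ψ x := by
      have := LinearMap.congr_fun hsum x
      simp only [LinearMap.add_apply, ContinuousLinearMap.coe_coe] at this
      simp [← this]
    have h := hψ (-x)
    rw [map_neg, norm_neg] at h
    rw [e, Real.norm_eq_abs, abs_le]
    exact ⟨by linarith, hψ x⟩

/-- If a Banach space `Z` is SSD at every point of its unit sphere, and `z_1, …, z_n ∈ S_Z`
admit a common norming functional `f ∈ S_{Z*}`, then for every `ε > 0` there is `η > 0` such
that every `g ∈ B_{Z*}` with `g(z_i) > 1 - η` for all `i` is `ε`-close to some `h ∈ S_{Z*}`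
with `h(z_i) = 1` for all `i`. -/
theorem multiple_point_ssd_of_ssd
    {Z : Type*} [NormedAddCommGroup Z] [NormedSpace ℝ Z] [CompleteSpace Z]
    (hZ : ∀ z : Z, ‖z‖ = 1 → IsSSDPoint z)
    (n : ℕ) (hn : 0 < n) (z : Fin n → Z) (hz : ∀ i, ‖z i‖ = 1)
    (f : Z →L[ℝ] ℝ) (hf : ‖f‖ = 1) (hfz : ∀ i, f (z i) = 1) :
    ∀ ε > (0 : ℝ), ∃ η > (0 : ℝ),
      ∀ g : Z →L[ℝ] ℝ, ‖g‖ ≤ 1 → (∀ i, 1 - η < g (z i)) →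
        ∃ h : Z →L[ℝ] ℝ, ‖h‖ = 1 ∧ (∀ i, h (z i) = 1) ∧ ‖g - h‖ < ε := by
  intro ε hε
  have hn' : (0 : ℝ) < n := Nat.cast_pos.mpr hn
  set w : Z := (n : ℝ)⁻¹ • ∑ i, z i with hw
  have happly : ∀ g : Z →L[ℝ] ℝ, g w = (n : ℝ)⁻¹ * ∑ i, g (z i) := fun g => by simp [hw]
  have hw1 : ‖w‖ = 1 := by
    refine le_antisymm ?_ ?_
    · rw [hw, norm_smul, Real.norm_of_nonneg (by positivity), inv_mul_le_iff₀ hn']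
      exact (norm_sum_le _ _).trans (by simp [hz])
    · have h := f.le_opNorm w
      rw [happly] at h
      simpa [hfz, hf, hn'.ne'] using h
  obtain ⟨η, hη, H⟩ := (hZ w hw1).exists_support_functional_near hε
  refine ⟨η, hη, fun g hg hgz => ?_⟩
  have hgw : 1 - η < g w := by
    rw [happly, lt_inv_mul_iff₀ hn']
    have : ∑ _i : Fin n, (1 - η) < ∑ i, g (z i) :=
      Finset.sum_lt_sum_of_nonempty ⟨⟨0, hn⟩, Finset.mem_univ _⟩ fun i _ => hgz i
    simpa [mul_sub] using this
  obtain ⟨h, hh, hhw, hgh⟩ := H g hg hgw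
  refine ⟨h, hh, ?_, hgh⟩
  have hle : ∀ i ∈ Finset.univ, h (z i) ≤ 1 := fun i _ =>
    (le_abs_self _).trans ((h.le_opNorm (z i)).trans_eq (by rw [hh, hz, one_mul]))
  have hsum : ∑ i, h (z i) = ∑ _i : Fin n, (1 : ℝ) := by
    rw [happly, inv_mul_eq_iff_eq_mul₀ hn'.ne'] at hhw
    simpa using hhw
  exact fun i => (Finset.sum_eq_sum_iff_of_le hle).mp hsum i (Finset.mem_univ i)
end

section
/- Let X and Y be Banach spaces and let z ∈ X ⊗̂_π Y admit a representation z = Σ_{n=1}^∞ λ_n x_n ⊗ y_n with x_n ∈ S_X, y_n ∈ S_Y, λ_n > 0 for every n ∈ ℕ, and Σ_{n=1}^∞ λ_n = ‖z‖_π. If T : X → Y* is a bounded linear operator with ‖T‖ = 1 which, regarded as a functional on X ⊗̂_π Y, satisfies T(z) = ‖z‖_π, then T(x_n)(y_n) = 1 and ‖T(x_n)‖ = 1 for every n ∈ ℕ. -/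
/-- The set of all sums `Σ ‖u i‖ * ‖v i‖` over finite representations
`z = Σ u i ⊗ v i` of `z` as a sum of elementary tensors. -/
def projRepSums {X Y Z : Type*} [NormedAddCommGroup X] [NormedSpace ℝ X]
    [NormedAddCommGroup Y] [NormedSpace ℝ Y] [NormedAddCommGroup Z] [NormedSpace ℝ Z]
    (tp : X →ₗ[ℝ] Y →ₗ[ℝ] Z) (z : Z) : Set ℝ :=
  { r | ∃ (k : ℕ) (u : Fin k → X) (v : Fin k → Y),
      z = ∑ i, tp (u i) (v i) ∧ r = ∑ i, ‖u i‖ * ‖v i‖ }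

/-- The Banach space `Z`, together with the bilinear map `tp`, is (an isometric copy of) the
projective tensor product `X ⊗̂_π Y`: the span of the elementary tensors is dense in `Z`, and the
norm of any finite sum of elementary tensors is its projective norm, i.e. the infimum of
`Σ ‖u i‖ * ‖v i‖` over all finite representations. -/
structure IsProjectiveTensorProduct {X Y Z : Type*} [NormedAddCommGroup X] [NormedSpace ℝ X]
    [NormedAddCommGroup Y] [NormedSpace ℝ Y] [NormedAddCommGroup Z] [NormedSpace ℝ Z]
    [CompleteSpace Z] (tp : X →ₗ[ℝ] Y →ₗ[ℝ] Z) : Prop where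
  dense_span : Dense ((Submodule.span ℝ
    (Set.range fun xy : X × Y => tp xy.1 xy.2) : Submodule ℝ Z) : Set Z)
  norm_eq : ∀ (k : ℕ) (u : Fin k → X) (v : Fin k → Y),
    ‖∑ i, tp (u i) (v i)‖ = sInf (projRepSums tp (∑ i, tp (u i) (v i)))

/-- Elementary tensors have norm at most the product of the norms of their factors. -/
theorem IsProjectiveTensorProduct.norm_apply_le {X Y Z : Type*}
    [NormedAddCommGroup X] [NormedSpace ℝ X] [NormedAddCommGroup Y] [NormedSpace ℝ Y]
    [NormedAddCommGroup Z] [NormedSpace ℝ Z] [CompleteSpace Z]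
    {tp : X →ₗ[ℝ] Y →ₗ[ℝ] Z} (htp : IsProjectiveTensorProduct tp) (a : X) (b : Y) :
    ‖tp a b‖ ≤ ‖a‖ * ‖b‖ := by
  have h := htp.norm_eq 1 (fun _ => a) (fun _ => b)
  simp only [Fin.sum_univ_one] at h
  rw [h]
  refine csInf_le ⟨0, ?_⟩ ⟨1, fun _ => a, fun _ => b, by simp, by simp⟩
  rintro r ⟨k, u, v, -, rfl⟩
  positivity

/-- **Remark 3.10.** If `z ∈ X ⊗̂_π Y` attains its projective norm through the representation
`z = Σ_{n=1}^∞ λ_n x_n ⊗ y_n` with `x_n ∈ S_X`, `y_n ∈ S_Y`, `λ_n > 0` and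
`Σ λ_n = ‖z‖_π`, and `T : X → Y*` is a norm-one operator which, regarded as a functional `φ`
on `X ⊗̂_π Y`, satisfies `T(z) = ‖z‖_π`, then `T(x_n)(y_n) = 1` and `‖T(x_n)‖ = 1` for
every `n`. -/
theorem norming_functional_of_projNorm_attaining
    {X Y Z : Type*} [NormedAddCommGroup X] [NormedSpace ℝ X]
    [NormedAddCommGroup Y] [NormedSpace ℝ Y]
    [NormedAddCommGroup Z] [NormedSpace ℝ Z] [CompleteSpace Z]
    [CompleteSpace X] [CompleteSpace Y]
    (tp : X →ₗ[ℝ] Y →ₗ[ℝ] Z) (htp : IsProjectiveTensorProduct tp)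
    (z : Z) (lam : ℕ → ℝ) (x : ℕ → X) (y : ℕ → Y)
    (hx : ∀ n, ‖x n‖ = 1) (hy : ∀ n, ‖y n‖ = 1) (hlam : ∀ n, 0 < lam n)
    (hlam_summable : Summable lam)
    (hz : z = ∑' n : ℕ, lam n • tp (x n) (y n))
    (hattain : ∑' n : ℕ, lam n = ‖z‖)
    (T : X →L[ℝ] Y →L[ℝ] ℝ) (hT : ‖T‖ = 1)
    (φ : Z →L[ℝ] ℝ) (hφT : ∀ (a : X) (b : Y), φ (tp a b) = T a b)
    (hTz : φ z = ‖z‖) :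
    ∀ n, T (x n) (y n) = 1 ∧ ‖T (x n)‖ = 1 := by
  have hop : ∀ n, ‖T (x n)‖ ≤ 1 := fun n => by
    simpa [hT, hx n] using T.le_opNorm (x n)
  have hle : ∀ n, |T (x n) (y n)| ≤ ‖T (x n)‖ := fun n => by
    simpa [hy n] using (T (x n)).le_opNorm (y n)
  have hsum : Summable fun n => lam n • tp (x n) (y n) := by
    refine Summable.of_norm_bounded hlam_summable fun n => ?_
    rw [norm_smul, Real.norm_of_nonneg (hlam n).le]
    have h := htp.norm_apply_le (x n) (y n)
    rw [hx, hy, one_mul] at h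
    exact mul_le_of_le_one_right (hlam n).le h
  have hφz : HasSum (fun n => lam n * T (x n) (y n)) (∑' n, lam n) := by
    have h := φ.hasSum hsum.hasSum
    rw [← hz, hTz, ← hattain] at h
    simpa [hφT] using h
  have hone : ∀ n, T (x n) (y n) ≤ 1 := fun n =>
    (le_abs_self _).trans ((hle n).trans (hop n))
  have heq : ∀ n, T (x n) (y n) = 1 := by
    by_contra! hne
    obtain ⟨n, hn⟩ := hne
    exact lt_irrefl _ (hasSum_lt
      (fun m => mul_le_of_le_one_right (hlam m).le (hone m))
      (mul_lt_of_lt_one_right (hlam n) (lt_of_le_of_ne (hone n) hn))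
      hφz hlam_summable.hasSum)
  refine fun n => ⟨heq n, (hop n).antisymm ?_⟩
  simpa [heq n] using hle n
end
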